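/- arXiv:1807.04899 — 3 statements merged into one kernel-verified Lean document; each statement's English description precedes it below -/
import Mathlib

section
/- Let E be a real inner product space, let f : E → ℝ be differentiable with an L-Lipschitz continuous gradient (L ≥ 0), and let g : E → ℝ be convex. Fix τ > 0 and a point x ∈ E, and suppose x⁺ ∈ E is a minimizer over E of the function z ↦ (1/2)‖z − (x − τ·∇f(x))‖² + τ·g(z). Then, writing F = f + g, one has F(x⁺) − F(x) ≤ (L/2 − 1/τ)·‖x − x⁺‖². -/
open RealInnerProductSpace

/-- The descent lemma: a function with `L`-Lipschitz gradient is bounded above by its quadratic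
model. -/
theorem le_add_inner_add_of_lipschitz_gradient {E : Type*} [NormedAddCommGroup E]
    [InnerProductSpace ℝ E] {f : E → ℝ} {f' : E → E} {L : ℝ}
    (hf : ∀ x : E, HasFDerivAt f (InnerProductSpace.toDualMap ℝ E (f' x) : E →L[ℝ] ℝ) x)
    (hlip : ∀ x y : E, ‖f' x - f' y‖ ≤ L * ‖x - y‖) (x d : E) :
    f (x + d) ≤ f x + ⟪f' x, d⟫ + L / 2 * ‖d‖ ^ 2 := by
  have hφ (t : ℝ) : HasDerivAt (fun s : ℝ => f (x + s • d)) ⟪f' (x + t • d), d⟫ t := by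
    have hline : HasDerivAt (fun s : ℝ => x + s • d) d t := by
      simpa using ((hasDerivAt_id t).smul_const d).const_add x
    exact (hf (x + t • d)).comp_hasDerivAt t hline
  have hB (t : ℝ) : HasDerivAt (fun s : ℝ => f x + s * ⟪f' x, d⟫ + L / 2 * ‖d‖ ^ 2 * s ^ 2)
      (⟪f' x, d⟫ + L * t * ‖d‖ ^ 2) t := by
    have h := (((hasDerivAt_id t).mul_const ⟪f' x, d⟫).const_add (f x)).add
      ((hasDerivAt_pow 2 t).const_mul (L / 2 * ‖d‖ ^ 2))
    refine h.congr_deriv ?_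
    norm_num
    ring
  have bound (t : ℝ) (ht : 0 ≤ t) :
      ⟪f' (x + t • d), d⟫ ≤ ⟪f' x, d⟫ + L * t * ‖d‖ ^ 2 := by
    have hnorm : ‖f' (x + t • d) - f' x‖ ≤ L * (t * ‖d‖) := by
      simpa [norm_smul, abs_of_nonneg ht] using hlip (x + t • d) x
    rw [← sub_le_iff_le_add', ← inner_sub_left]
    calc ⟪f' (x + t • d) - f' x, d⟫ ≤ ‖f' (x + t • d) - f' x‖ * ‖d‖ := real_inner_le_norm _ _
      _ ≤ L * (t * ‖d‖) * ‖d‖ := by gcongr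
      _ = L * t * ‖d‖ ^ 2 := by ring
  simpa using image_le_of_deriv_right_le_deriv_boundary
    (fun t _ => (hφ t).continuousAt.continuousWithinAt) (fun t _ => (hφ t).hasDerivWithinAt)
    (by simp) (fun t _ => (hB t).continuousAt.continuousWithinAt)
    (fun t _ => (hB t).hasDerivWithinAt) (fun t ht => bound t ht.1)
    (Set.right_mem_Icc.2 (zero_le_one (α := ℝ)))

/-- The variational inequality satisfied by a proximal point `p` of `y`. -/
theorem ConvexOn.mul_sub_le_inner_of_prox {E : Type*} [NormedAddCommGroup E]
    [InnerProductSpace ℝ E] {g : E → ℝ} (hg : ConvexOn ℝ Set.univ g) {τ : ℝ} (hτ : 0 ≤ τ)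
    {y p : E}
    (hmin : ∀ z : E, (1 / 2) * ‖p - y‖ ^ 2 + τ * g p ≤ (1 / 2) * ‖z - y‖ ^ 2 + τ * g z) (z : E) :
    τ * (g p - g z) ≤ ⟪p - y, z - p⟫ := by
  set b := ‖z - p‖ ^ 2 / 2 with hb
  set a := ⟪p - y, z - p⟫ - τ * (g p - g z) with ha
  have hb0 : 0 ≤ b := by positivity
  have key (t : ℝ) (ht0 : 0 < t) (ht1 : t ≤ 1) : 0 ≤ a + t * b := by
    have hm := hmin (p + t • (z - p))
    have hconv : g (p + t • (z - p)) ≤ (1 - t) * g p + t * g z := by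
      have h := hg.2 (Set.mem_univ p) (Set.mem_univ z) (sub_nonneg.2 ht1) ht0.le (by ring)
      rwa [show (1 - t) • p + t • z = p + t • (z - p) by module] at h
    have hsq : ‖p + t • (z - p) - y‖ ^ 2 =
        ‖p - y‖ ^ 2 + 2 * (t * ⟪p - y, z - p⟫) + t ^ 2 * ‖z - p‖ ^ 2 := by
      rw [add_sub_right_comm, norm_add_sq_real, inner_smul_right, norm_smul, mul_pow,
        Real.norm_eq_abs, sq_abs]
    rw [hsq] at hm
    have hτg := mul_le_mul_of_nonneg_left hconv hτ
    refine nonneg_of_mul_nonneg_right ?_ ht0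
    rw [ha, hb]
    linarith
  suffices 0 ≤ a by linarith
  by_contra! hneg
  have hpos : 0 < b - a := by linarith
  have h := key (-a / (b - a)) (div_pos (by linarith) hpos) ((div_le_one hpos).2 (by linarith))
  have heq : a + -a / (b - a) * b = -(a ^ 2 / (b - a)) := by
    field_simp
    ring
  have : 0 < a ^ 2 / (b - a) := div_pos (sq_pos_of_neg hneg) hpos
  linarith

/-- Lemma 1 (proximal descent lemma): if `f` is differentiable with an `L`-Lipschitz
gradient `f'`, `g` is convex, `τ > 0`, and `x⁺` minimizes
`z ↦ (1/2)‖z − (x − τ∇f(x))‖² + τ g(z)`, then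
`F(x⁺) − F(x) ≤ (L/2 − 1/τ)‖x − x⁺‖²` where `F = f + g`. -/
theorem prox_descent_lemma {E : Type*} [NormedAddCommGroup E] [InnerProductSpace ℝ E]
    (f g : E → ℝ) (f' : E → E) (L : ℝ) (hL : 0 ≤ L)
    (hf : ∀ x : E, HasFDerivAt f ((InnerProductSpace.toDualMap ℝ E (f' x) : E →L[ℝ] ℝ)) x)
    (hlip : ∀ x y : E, ‖f' x - f' y‖ ≤ L * ‖x - y‖)
    (hg : ConvexOn ℝ Set.univ g)
    (τ : ℝ) (hτ : 0 < τ) (x xp : E)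
    (hmin : ∀ z : E,
      (1 / 2) * ‖xp - (x - τ • f' x)‖ ^ 2 + τ * g xp ≤
      (1 / 2) * ‖z - (x - τ • f' x)‖ ^ 2 + τ * g z) :
    (f xp + g xp) - (f x + g x) ≤ (L / 2 - 1 / τ) * ‖x - xp‖ ^ 2 := by
  have hdesc := le_add_inner_add_of_lipschitz_gradient hf hlip x (xp - x)
  have hprox := hg.mul_sub_le_inner_of_prox hτ.le hmin x
  rw [add_sub_cancel, norm_sub_rev, ← neg_sub x xp, inner_neg_right] at hdesc
  have hw : ⟪xp - (x - τ • f' x), x - xp⟫ = τ * ⟪f' x, x - xp⟫ - ‖x - xp‖ ^ 2 := by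
    rw [show xp - (x - τ • f' x) = τ • f' x - (x - xp) by abel, inner_sub_left,
      real_inner_smul_left, real_inner_self_eq_norm_sq]
  have hg' : g xp - g x ≤ ⟪f' x, x - xp⟫ - 1 / τ * ‖x - xp‖ ^ 2 := by
    refine le_of_mul_le_mul_left ?_ hτ
    rw [hw] at hprox
    calc τ * (g xp - g x) ≤ τ * ⟪f' x, x - xp⟫ - ‖x - xp‖ ^ 2 := hprox
      _ = τ * (⟪f' x, x - xp⟫ - 1 / τ * ‖x - xp‖ ^ 2) := by field_simp
  linarith
end

section
/- Let E be a real inner product space, let f : E → ℝ be differentiable, and let g : E → ℝ be convex. Fix τ > 0 and suppose a point x ∈ E satisfies the fixed-point condition that x itself is a minimizer over E of the function z ↦ (1/2)‖z − (x − τ·∇f(x))‖² + τ·g(z). Then x is a stationary point of F = f + g, i.e., −∇f(x) is a subgradient of g at x: for all y ∈ E, g(y) ≥ g(x) + ⟨−∇f(x), y − x⟩. -/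
open RealInnerProductSpace

/-- Lemma 2: if `x` is a fixed point of the proximal-gradient step
`x = prox_{τg}(x − τ∇f(x))`, then `x` is a stationary point of `F = f + g`,
i.e. `−∇f(x)` is a subgradient of `g` at `x`. -/
theorem prox_fixed_point_stationary {E : Type*} [NormedAddCommGroup E] [InnerProductSpace ℝ E]
    (f g : E → ℝ) (f' : E → E)
    (hf : ∀ x : E, HasFDerivAt f ((InnerProductSpace.toDualMap ℝ E (f' x) : E →L[ℝ] ℝ)) x)
    (hg : ConvexOn ℝ Set.univ g)
    (τ : ℝ) (hτ : 0 < τ) (x : E)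
    (hmin : ∀ z : E,
      (1 / 2) * ‖x - (x - τ • f' x)‖ ^ 2 + τ * g x ≤
      (1 / 2) * ‖z - (x - τ • f' x)‖ ^ 2 + τ * g z) :
    ∀ y : E, g y ≥ g x + ⟪-f' x, y - x⟫ := by
  intro y
  by_contra! h
  have hstep : ∀ t : ℝ, 0 < t → t ≤ 1 →
      0 ≤ t / 2 * ‖y - x‖ ^ 2 + τ * (⟪f' x, y - x⟫ + g y - g x) := by
    intro t ht ht1
    have hconv := hg.2 (Set.mem_univ x) (Set.mem_univ y) (sub_nonneg.2 ht1) ht.le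
      (sub_add_cancel 1 t)
    have hz : (1 - t) • x + t • y - (x - τ • f' x) = τ • f' x + t • (y - x) := by module
    have hx : x - (x - τ • f' x) = τ • f' x := by abel
    have hle := hmin ((1 - t) • x + t • y)
    rw [hz, hx, norm_add_sq_real, real_inner_smul_left, real_inner_smul_right,
      norm_smul t, Real.norm_eq_abs, mul_pow, sq_abs] at hle
    simp only [smul_eq_mul] at hconv
    have hτconv := mul_le_mul_of_nonneg_left hconv hτ.le
    refine nonneg_of_mul_nonneg_right (a := t) ?_ ht
    linarith
  rw [inner_neg_left] at h
  set A := ⟪f' x, y - x⟫ + g y - g x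
  set D := ‖y - x‖ ^ 2
  have hB : 0 < -(τ * A) := by
    have : A < 0 := by linarith
    nlinarith
  have hDnonneg : 0 ≤ D := by positivity
  set B := -(τ * A)
  have hDB : 0 < D + B := by linarith
  have hle := hstep (B / (D + B)) (div_pos hB hDB) ((div_le_one hDB).2 (by linarith))
  have hlt : B / (D + B) / 2 * D < B := by
    rw [div_div, div_mul_eq_mul_div, div_lt_iff₀ (by linarith)]
    nlinarith
  linarith
end

section
/- Let E be a real inner product space, let a, Z ∈ E, and let ρ > 0 and μ > 0. Suppose ε⁺ ∈ E is a minimizer over E of the function ε ↦ ⟨Z, a − ε⟩ + (μ/2)‖a − ε‖² + (ρ/2)‖ε‖², and define the dual update Z⁺ = Z + μ·(a − ε⁺). Then Z⁺ = ρ·ε⁺. -/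
open RealInnerProductSpace

/-- Lemma 3: if `ε⁺` minimizes `ε ↦ ⟨Z, a − ε⟩ + (μ/2)‖a − ε‖² + (ρ/2)‖ε‖²` and the
dual variable is updated by `Z⁺ = Z + μ(a − ε⁺)`, then `Z⁺ = ρ ε⁺`. -/
theorem dual_update_eq_rho_smul_slack {E : Type*} [NormedAddCommGroup E]
    [InnerProductSpace ℝ E]
    (a Z : E) (ρ μ : ℝ) (hρ : 0 < ρ) (hμ : 0 < μ) (εp : E)
    (hmin : ∀ ε : E,
      ⟪Z, a - εp⟫ + (μ / 2) * ‖a - εp‖ ^ 2 + (ρ / 2) * ‖εp‖ ^ 2 ≤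
      ⟪Z, a - ε⟫ + (μ / 2) * ‖a - ε‖ ^ 2 + (ρ / 2) * ‖ε‖ ^ 2) :
    Z + μ • (a - εp) = ρ • εp := by
  set b := a - εp with hb
  obtain ⟨g, hg⟩ : ∃ g : E, g = Z + μ • b - ρ • εp := ⟨_, rfl⟩
  have hsq : ‖g‖ ^ 2 = ⟪Z, g⟫ + μ * ⟪b, g⟫ - ρ * ⟪εp, g⟫ := by
    rw [← real_inner_self_eq_norm_sq]
    nth_rewrite 1 [hg]
    rw [inner_sub_left, inner_add_left, real_inner_smul_left, real_inner_smul_left]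
  have hs : 0 < μ + ρ := add_pos hμ hρ
  obtain ⟨t, ht⟩ : ∃ t : ℝ, t = (μ + ρ)⁻¹ := ⟨_, rfl⟩
  have htpos : 0 < t := ht ▸ inv_pos.mpr hs
  have hts : (μ + ρ) * t = 1 := ht ▸ mul_inv_cancel₀ hs.ne'
  have h := hmin (εp + t • g)
  rw [← sub_sub, ← hb, inner_sub_right Z b, norm_sub_sq_real b (t • g), norm_add_sq_real,
    real_inner_smul_right, real_inner_smul_right, real_inner_smul_right, norm_smul, mul_pow,
    Real.norm_eq_abs, sq_abs] at h
  have hle : t * ‖g‖ ^ 2 ≤ 0 := by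
    linear_combination 2 * h + 2 * t * hsq + t * ‖g‖ ^ 2 * hts
  have hg0 : g = 0 := by
    by_contra hne
    have : 0 < ‖g‖ := norm_pos_iff.mpr hne
    exact absurd hle (not_le.mpr (by positivity))
  exact sub_eq_zero.mp (hg.symm.trans hg0)
end
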